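/- arXiv:2011.05252 — 4 statements merged into one kernel-verified Lean document; each statement's English description precedes it below -/
import Mathlib

section
/- Equivariance of the invariants: let g_i ∈ GL(α_i,k) for 1 ≤ i ≤ p and h_j ∈ GL(β_j,k) for 1 ≤ j ≤ q, let G ∈ GL(n,k) be the block diagonal matrix with blocks g_1,...,g_p with respect to the V-decomposition, and H ∈ GL(n,k) the block diagonal matrix with blocks h_1,...,h_q with respect to the W-decomposition. Then for every A ∈ GL(n,k) and all i, j: χ_ij(H·A·G^{−1}) = {(g_i ξ, h_j η) : (ξ,η) ∈ χ_ij(A)}. -/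
namespace Neretin

open scoped BigOperators

variable {k : Type*} [Field k]

/-- Offset of the `i`-th block of the partition `α`. -/
def off {p : ℕ} (α : Fin p → ℕ) (i : Fin p) : ℕ := ∑ i' ∈ Finset.Iio i, α i'

theorem coord_lt {p n : ℕ} {α : Fin p → ℕ} (hα : ∑ i, α i = n) (i : Fin p)
    (t : Fin (α i)) : off α i + (t : ℕ) < n := by
  have h1 : off α i + α i ≤ n := by
    rw [← hα]
    have h2 : insert i (Finset.Iio i) = Finset.Iic i := Finset.Iio_insert i
    have h3 : off α i + α i = ∑ i' ∈ Finset.Iic i, α i' := by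
      rw [← h2, Finset.sum_insert (by simp)]
      unfold off
      omega
    rw [h3]
    exact Finset.sum_le_sum_of_subset (Finset.subset_univ _)
  have h4 := t.isLt
  omega

/-- The coordinate of `k^n` corresponding to the `t`-th coordinate of the `i`-th block. -/
def coord {p n : ℕ} {α : Fin p → ℕ} (hα : ∑ i, α i = n) (i : Fin p) (t : Fin (α i)) : Fin n :=
  ⟨off α i + (t : ℕ), coord_lt hα i t⟩

/-- Subspace of vectors vanishing at all coordinates satisfying `P`. -/
def vanishOn {ι : Type*} (P : ι → Prop) : Submodule k (ι → k) :=
  ⨅ r ∈ {r : ι | P r}, LinearMap.ker (LinearMap.proj (R := k) (φ := fun _ : ι => k) r)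

/-- The linear relation `χ_ij(A) : V_i ⇉ W_j`. -/
def chi {p q n : ℕ} (α : Fin p → ℕ) (β : Fin q → ℕ) (hα : ∑ i, α i = n) (hβ : ∑ j, β j = n)
    (A : Matrix (Fin n) (Fin n) k) (i : Fin p) (j : Fin q) :
    Submodule k ((Fin (α i) → k) × (Fin (β j) → k)) :=
  Submodule.map
    ((LinearMap.funLeft k k (coord hα i)).prod
      ((LinearMap.funLeft k k (coord hβ j)).comp (Matrix.mulVecLin A)))
    (vanishOn (fun r : Fin n => off α i + α i ≤ (r : ℕ)) ⊓
      Submodule.comap (Matrix.mulVecLin A) (vanishOn fun r : Fin n => (r : ℕ) < off β j))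

section Rel

variable {X Y : Type*} [AddCommGroup X] [Module k X] [AddCommGroup Y] [Module k Y]

/-- Kernel of a linear relation. -/
def rker (L : Submodule k (X × Y)) : Submodule k X := Submodule.comap (LinearMap.inl k X Y) L

/-- Domain of a linear relation. -/
def rdom (L : Submodule k (X × Y)) : Submodule k X := Submodule.map (LinearMap.fst k X Y) L

/-- Image of a linear relation. -/
def rim (L : Submodule k (X × Y)) : Submodule k Y := Submodule.map (LinearMap.snd k X Y) L

/-- Indefiniteness of a linear relation. -/
def rindef (L : Submodule k (X × Y)) : Submodule k Y := Submodule.comap (LinearMap.inr k X Y) L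

end Rel

/-- `blockLT α a b`: coordinate `a` lies in a strictly earlier block than `b`. -/
def blockLT {p : ℕ} (α : Fin p → ℕ) (a b : ℕ) : Prop :=
  ∃ i : Fin p, off α i ≤ b ∧ a < off α i

/-- `sameBlock α a b` : coordinates `a`, `b` lie in the same block. -/
def sameBlock {p : ℕ} (α : Fin p → ℕ) (a b : ℕ) : Prop :=
  ∀ i : Fin p, off α i ≤ a ↔ off α i ≤ b

/-- Block upper triangular matrices (the group `P_+`). -/
def IsPPlus {n p : ℕ} (α : Fin p → ℕ) (g : Matrix (Fin n) (Fin n) k) : Prop :=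
  ∀ r s : Fin n, blockLT α (s : ℕ) (r : ℕ) → g r s = 0

/-- Block lower triangular matrices (the group `P_-`). -/
def IsPMinus {n p : ℕ} (α : Fin p → ℕ) (g : Matrix (Fin n) (Fin n) k) : Prop :=
  ∀ r s : Fin n, blockLT α (r : ℕ) (s : ℕ) → g r s = 0

/-- Block strictly upper triangular matrices (the group `T_+`). -/
def IsTPlus {n p : ℕ} (α : Fin p → ℕ) (g : Matrix (Fin n) (Fin n) k) : Prop :=
  IsPPlus α g ∧ ∀ r s : Fin n, sameBlock α (r : ℕ) (s : ℕ) → g r s = if r = s then 1 else 0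

/-- Block strictly lower triangular matrices (the group `T_-`). -/
def IsTMinus {n p : ℕ} (α : Fin p → ℕ) (g : Matrix (Fin n) (Fin n) k) : Prop :=
  IsPMinus α g ∧ ∀ r s : Fin n, sameBlock α (r : ℕ) (s : ℕ) → g r s = if r = s then 1 else 0

/-- Bi-hinges. -/
def IsBiHinge {p q : ℕ} (α : Fin p → ℕ) (β : Fin q → ℕ)
    (ξ : (i : Fin p) → (j : Fin q) → Submodule k ((Fin (α i) → k) × (Fin (β j) → k))) : Prop :=
  (∀ (i : Fin p) (j j' : Fin q), (j' : ℕ) = (j : ℕ) + 1 → rker (ξ i j) = rdom (ξ i j')) ∧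
  (∀ (i i' : Fin p) (j : Fin q), (i' : ℕ) = (i : ℕ) + 1 → rim (ξ i j) = rindef (ξ i' j)) ∧
  (∀ (i : Fin p) (j : Fin q), (i : ℕ) = 0 → rindef (ξ i j) = ⊥) ∧
  (∀ (i : Fin p) (j : Fin q), (i : ℕ) + 1 = p → rim (ξ i j) = ⊤) ∧
  (∀ (i : Fin p) (j : Fin q), (j : ℕ) + 1 = q → rker (ξ i j) = ⊥) ∧
  (∀ (i : Fin p) (j : Fin q), (j : ℕ) = 0 → rdom (ξ i j) = ⊤)

/-- 0-1 matrices with exactly one unit in each row and each column. -/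
def IsPermMatrix {n : ℕ} (M : Matrix (Fin n) (Fin n) k) : Prop :=
  ∃ σ : Equiv.Perm (Fin n), ∀ r s, M r s = if r = σ s then 1 else 0

/-- Offset of the sub-block `V_i^j` inside `V_i`. -/
def offA {p q : ℕ} (a : Fin p → Fin q → ℕ) (i : Fin p) (j : Fin q) : ℕ :=
  ∑ j' ∈ Finset.Iio j, a i j'

/-- Offset of the sub-block `W_j^i` inside `W_j`. -/
def offB {p q : ℕ} (a : Fin p → Fin q → ℕ) (i : Fin p) (j : Fin q) : ℕ :=
  ∑ i' ∈ Finset.Iio i, a i' j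

open Classical in
/-- The standard 0-1 matrix determined by the dimension data `a`. -/
noncomputable def stdMatrix {p q : ℕ} (n : ℕ) (α : Fin p → ℕ) (β : Fin q → ℕ)
    (a : Fin p → Fin q → ℕ) : Matrix (Fin n) (Fin n) k :=
  Matrix.of fun r s : Fin n =>
    if ∃ (i : Fin p) (j : Fin q) (t : ℕ), t < a i j ∧
        (s : ℕ) = off α i + offA a i j + t ∧ (r : ℕ) = off β j + offB a i j + t
      then (1 : k) else 0

/-- The standard bi-hinge determined by the dimension data `a`. -/
def stdHinge {p q : ℕ} (α : Fin p → ℕ) (β : Fin q → ℕ) (a : Fin p → Fin q → ℕ)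
    (i : Fin p) (j : Fin q) : Submodule k ((Fin (α i) → k) × (Fin (β j) → k)) where
  carrier := {z | (∀ u : Fin (α i), (u : ℕ) < offA a i j → z.1 u = 0) ∧
    (∀ v : Fin (β j), offB a i j + a i j ≤ (v : ℕ) → z.2 v = 0) ∧
    ∀ (u : Fin (α i)) (v : Fin (β j)) (t : ℕ), t < a i j →
      (u : ℕ) = offA a i j + t → (v : ℕ) = offB a i j + t → z.1 u = z.2 v}
  add_mem' := by
    rintro x y ⟨hx1, hx2, hx3⟩ ⟨hy1, hy2, hy3⟩
    refine ⟨fun u hu => ?_, fun v hv => ?_, fun u v t ht hu hv => ?_⟩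
    · show x.1 u + y.1 u = 0
      rw [hx1 u hu, hy1 u hu, add_zero]
    · show x.2 v + y.2 v = 0
      rw [hx2 v hv, hy2 v hv, add_zero]
    · show x.1 u + y.1 u = x.2 v + y.2 v
      rw [hx3 u v t ht hu hv, hy3 u v t ht hu hv]
  zero_mem' := ⟨fun _ _ => rfl, fun _ _ => rfl, fun _ _ _ _ _ _ => rfl⟩
  smul_mem' := by
    rintro c x ⟨hx1, hx2, hx3⟩
    refine ⟨fun u hu => ?_, fun v hv => ?_, fun u v t ht hu hv => ?_⟩
    · show c * x.1 u = 0
      rw [hx1 u hu, mul_zero]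
    · show c * x.2 v = 0
      rw [hx2 v hv, mul_zero]
    · show c * x.1 u = c * x.2 v
      rw [hx3 u v t ht hu hv]

theorem mem_vanishOn {ι : Type*} {P : ι → Prop} {x : ι → k} :
    x ∈ vanishOn (k := k) P ↔ ∀ r, P r → x r = 0 := by
  simp [vanishOn]

theorem off_add_eq_or {p n : ℕ} {α : Fin p → ℕ} (hα : ∑ i, α i = n) (i : Fin p) :
    off α i + α i = n ∨ ∃ i' : Fin p, off α i' = off α i + α i := by
  have key : off α i + α i = ∑ i' ∈ Finset.Iic i, α i' := by
    rw [← Finset.Iio_insert i, Finset.sum_insert (by simp), add_comm, off]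
  by_cases hi : (i : ℕ) + 1 < p
  · refine Or.inr ⟨⟨i + 1, hi⟩, ?_⟩
    rw [key, off]
    congr 1
    ext a
    simp only [Finset.mem_Iio, Finset.mem_Iic, Fin.lt_def, Fin.le_def]
    omega
  · left
    rw [key, ← hα]
    congr 1
    ext a
    simp only [Finset.mem_Iic, Fin.le_def, Finset.mem_univ, iff_true]
    omega

theorem sameBlock.off_add_le_iff {p n : ℕ} {α : Fin p → ℕ} (hα : ∑ i, α i = n) (i : Fin p)
    {r s : Fin n} (hrs : sameBlock α (r : ℕ) (s : ℕ)) :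
    off α i + α i ≤ (r : ℕ) ↔ off α i + α i ≤ (s : ℕ) := by
  rcases off_add_eq_or hα i with h | ⟨i', h⟩
  · omega
  · rw [← h]
    exact hrs i'

theorem coord_injective {p n : ℕ} {α : Fin p → ℕ} (hα : ∑ i, α i = n) (i : Fin p) :
    Function.Injective (coord hα i) := by
  intro t s hts
  have := congrArg Fin.val hts
  simp only [coord] at this
  exact Fin.ext (by omega)

theorem exists_coord_of_sameBlock {p n : ℕ} {α : Fin p → ℕ} (hα : ∑ i, α i = n) (i : Fin p)
    (t : Fin (α i)) {s : Fin n} (hs : sameBlock α (coord hα i t : ℕ) (s : ℕ)) :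
    ∃ u, coord hα i u = s := by
  have h1 := hs i
  have h2 := hs.off_add_le_iff hα i
  have ht := t.isLt
  simp only [coord] at h1 h2
  exact ⟨⟨s - off α i, by omega⟩, Fin.ext (by simp only [coord]; omega)⟩

/-- A block diagonal matrix acts on each block through its diagonal block. -/
theorem mulVec_coord {p n : ℕ} {α : Fin p → ℕ} (hα : ∑ i, α i = n) (i : Fin p)
    {M : Matrix (Fin n) (Fin n) k} {m : Matrix (Fin (α i)) (Fin (α i)) k}
    (hblk : ∀ t s, M (coord hα i t) (coord hα i s) = m t s)
    (hoff : ∀ r s : Fin n, ¬ sameBlock α (r : ℕ) (s : ℕ) → M r s = 0)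
    (x : Fin n → k) (t : Fin (α i)) :
    M.mulVec x (coord hα i t) = m.mulVec (fun u => x (coord hα i u)) t := by
  simp only [Matrix.mulVec, dotProduct, ← hblk]
  symm
  refine Fintype.sum_of_injective _ (coord_injective hα i) _ _ (fun s hs => ?_) fun _ => rfl
  rw [hoff, zero_mul]
  exact fun hsb => hs (exists_coord_of_sameBlock hα i t hsb)

theorem mulVec_mem_vanishOn {p n : ℕ} {α : Fin p → ℕ} {M : Matrix (Fin n) (Fin n) k}
    (hoff : ∀ r s : Fin n, ¬ sameBlock α (r : ℕ) (s : ℕ) → M r s = 0) {P : Fin n → Prop}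
    (hP : ∀ r s : Fin n, sameBlock α (r : ℕ) (s : ℕ) → (P r ↔ P s)) {x : Fin n → k}
    (hx : x ∈ vanishOn (k := k) P) : M.mulVec x ∈ vanishOn (k := k) P := by
  rw [mem_vanishOn] at hx ⊢
  intro r hr
  rw [Matrix.mulVec, dotProduct]
  refine Finset.sum_eq_zero fun s _ => ?_
  by_cases hrs : sameBlock α (r : ℕ) (s : ℕ)
  · rw [hx s ((hP r s hrs).1 hr), mul_zero]
  · rw [hoff r s hrs, zero_mul]

/-- An invertible matrix stabilising a subspace reflects membership in it. -/
theorem mem_of_mulVec_mem {n : ℕ} (M : GL (Fin n) k) {U : Submodule k (Fin n → k)}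
    (hU : ∀ x ∈ U, M.val.mulVec x ∈ U) {x : Fin n → k} (hx : M.val.mulVec x ∈ U) : x ∈ U := by
  have hinj : Function.Injective (Matrix.mulVecLin M.val) :=
    Matrix.mulVec_injective_of_isUnit M.isUnit
  have hmap : U.map (Matrix.mulVecLin M.val) = U :=
    Submodule.eq_of_le_of_finrank_eq (Submodule.map_le_iff_le_comap.2 hU)
      (Submodule.equivMapOfInjective _ hinj U).finrank_eq.symm
  rw [← hmap] at hx
  obtain ⟨y, hy, hyx⟩ := hx
  exact hinj hyx ▸ hy

theorem mulVec_mem_vanishOn_iff {p n : ℕ} {α : Fin p → ℕ} (M : GL (Fin n) k)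
    (hoff : ∀ r s : Fin n, ¬ sameBlock α (r : ℕ) (s : ℕ) → M.val r s = 0) {P : Fin n → Prop}
    (hP : ∀ r s : Fin n, sameBlock α (r : ℕ) (s : ℕ) → (P r ↔ P s)) {x : Fin n → k} :
    M.val.mulVec x ∈ vanishOn (k := k) P ↔ x ∈ vanishOn (k := k) P :=
  ⟨mem_of_mulVec_mem M fun _ => mulVec_mem_vanishOn hoff hP, mulVec_mem_vanishOn hoff hP⟩

theorem mem_chi {p q n : ℕ} {α : Fin p → ℕ} {β : Fin q → ℕ} (hα : ∑ i, α i = n)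
    (hβ : ∑ j, β j = n) (A : Matrix (Fin n) (Fin n) k) (i : Fin p) (j : Fin q)
    (z : (Fin (α i) → k) × (Fin (β j) → k)) :
    z ∈ chi α β hα hβ A i j ↔ ∃ x : Fin n → k,
      (x ∈ vanishOn (k := k) (fun r : Fin n => off α i + α i ≤ (r : ℕ)) ∧
        A.mulVec x ∈ vanishOn (k := k) fun r : Fin n => (r : ℕ) < off β j) ∧
      ((fun t => x (coord hα i t), fun t => A.mulVec x (coord hβ j t)) :
        (Fin (α i) → k) × (Fin (β j) → k)) = z :=
  Iff.rfl

theorem statement11 (p q n : ℕ) (hp : 0 < p) (hq : 0 < q)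
    (α : Fin p → ℕ) (β : Fin q → ℕ)
    (hαpos : ∀ i, 0 < α i) (hβpos : ∀ j, 0 < β j)
    (hα : ∑ i, α i = n) (hβ : ∑ j, β j = n)
    (A : GL (Fin n) k)
    (g : ∀ i, GL (Fin (α i)) k) (h : ∀ j, GL (Fin (β j)) k)
    (G H : GL (Fin n) k)
    (hGblk : ∀ (i : Fin p) (t s : Fin (α i)),
      G.val (coord hα i t) (coord hα i s) = (g i).val t s)
    (hGoff : ∀ r s : Fin n, ¬ sameBlock α (r : ℕ) (s : ℕ) → G.val r s = 0)
    (hHblk : ∀ (j : Fin q) (t s : Fin (β j)),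
      H.val (coord hβ j t) (coord hβ j s) = (h j).val t s)
    (hHoff : ∀ r s : Fin n, ¬ sameBlock β (r : ℕ) (s : ℕ) → H.val r s = 0)
    (i : Fin p) (j : Fin q) :
    chi α β hα hβ ((H * A * G⁻¹).val) i j =
      Submodule.map
        (LinearMap.prodMap (Matrix.mulVecLin (g i).val) (Matrix.mulVecLin (h j).val))
        (chi α β hα hβ A.val i j) := by
  have hV : ∀ r s : Fin n, sameBlock α (r : ℕ) (s : ℕ) →
      (off α i + α i ≤ (r : ℕ) ↔ off α i + α i ≤ (s : ℕ)) :=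
    fun _ _ hrs => hrs.off_add_le_iff hα i
  have hW : ∀ r s : Fin n, sameBlock β (r : ℕ) (s : ℕ) →
      ((r : ℕ) < off β j ↔ (s : ℕ) < off β j) := fun _ _ hrs => by
    have := hrs j
    omega
  have hmul : ∀ y, (H * A * G⁻¹).val.mulVec (G.val.mulVec y) = H.val.mulVec (A.val.mulVec y) := by
    intro y
    rw [Matrix.mulVec_mulVec, Matrix.mulVec_mulVec, ← Units.val_mul, ← Units.val_mul,
      inv_mul_cancel_right]
  have hpair : ∀ y : Fin n → k,
      ((fun t => G.val.mulVec y (coord hα i t),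
        fun t => H.val.mulVec (A.val.mulVec y) (coord hβ j t)) :
        (Fin (α i) → k) × (Fin (β j) → k)) =
      LinearMap.prodMap (Matrix.mulVecLin (g i).val) (Matrix.mulVecLin (h j).val)
        (fun t => y (coord hα i t), fun t => A.val.mulVec y (coord hβ j t)) := fun y =>
    Prod.ext (funext (mulVec_coord hα i (hGblk i) hGoff y))
      (funext (mulVec_coord hβ j (hHblk j) hHoff _))
  ext z
  rw [Submodule.mem_map, mem_chi]
  constructor
  · rintro ⟨x, ⟨hx, hAx⟩, rfl⟩
    obtain ⟨y, rfl⟩ : ∃ y, G.val.mulVec y = x :=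
      ⟨(G⁻¹).val.mulVec x, by rw [Matrix.mulVec_mulVec, ← Units.val_mul]; simp⟩
    rw [hmul] at hAx ⊢
    rw [mulVec_mem_vanishOn_iff G hGoff hV] at hx
    rw [mulVec_mem_vanishOn_iff H hHoff hW] at hAx
    exact ⟨_, (mem_chi hα hβ A.val i j _).2 ⟨y, ⟨hx, hAx⟩, rfl⟩, (hpair y).symm⟩
  · rintro ⟨w, hw, rfl⟩
    obtain ⟨y, ⟨hy, hAy⟩, rfl⟩ := (mem_chi hα hβ A.val i j w).1 hw
    refine ⟨G.val.mulVec y, ⟨(mulVec_mem_vanishOn_iff G hGoff hV).2 hy, ?_⟩, ?_⟩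
    · rw [hmul]
      exact (mulVec_mem_vanishOn_iff H hHoff hW).2 hAy
    · rw [hmul]
      exact hpair y

end Neretin
end

section
/- Every orbit of the group ∏_{i=1}^p GL(α_i,k) × ∏_{j=1}^q GL(β_j,k) acting on the set of bi-hinges contains a standard bi-hinge: for every bi-hinge (ξ_ij) there exist g_i ∈ GL(α_i,k), h_j ∈ GL(β_j,k), and dimension data (α_i^j) with Σ_j α_i^j = α_i and Σ_i α_i^j = β_j, such that ((g,h)·ξ)_ij is the standard bi-hinge determined by (α_i^j). (Existence part of Lemma 2.3(a).) -/
namespace Neretin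

open scoped BigOperators

variable {k : Type*} [Field k]

/-- A finite family in `D` which is a basis of `D` modulo `K`. -/
structure IsRelBasis {V τ : Type*} [AddCommGroup V] [Module k V] [Fintype τ]
    (D K : Submodule k V) (v : τ → V) : Prop where
  mem : ∀ t, v t ∈ D
  indep : ∀ c : τ → k, ∑ t, c t • v t ∈ K → c = 0
  span : ∀ x ∈ D, ∃ c : τ → k, x - ∑ t, c t • v t ∈ K

theorem exists_isRelBasis {V : Type*} [AddCommGroup V] [Module k V] [FiniteDimensional k V]
    (D K : Submodule k V) : ∃ (m : ℕ) (v : Fin m → V), IsRelBasis D K v := by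
  let b := Module.finBasis k (D.map K.mkQ)
  have hb : ∀ t, ∃ x ∈ D, K.mkQ x = b t := fun t => Submodule.mem_map.mp (b t).2
  choose v hvD hv using hb
  have hsum : ∀ c : _ → k, K.mkQ (∑ t, c t • v t) = ((∑ t, c t • b t : D.map K.mkQ) : V ⧸ K) := by
    intro c
    rw [map_sum, Submodule.coe_sum]
    exact Finset.sum_congr rfl fun t _ => by rw [map_smul, hv, Submodule.coe_smul]
  refine ⟨_, v, hvD, fun c hc => ?_, fun x hx => ?_⟩
  · have h0 : K.mkQ (∑ t, c t • v t) = 0 := (Submodule.Quotient.mk_eq_zero K).mpr hc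
    rw [hsum, Submodule.coe_eq_zero] at h0
    exact funext (Fintype.linearIndependent_iff.mp b.linearIndependent c h0)
  · refine ⟨b.repr ⟨K.mkQ x, Submodule.mem_map_of_mem hx⟩, ?_⟩
    refine (Submodule.Quotient.mk_eq_zero K).mp ?_
    rw [← Submodule.mkQ_apply, map_sub, hsum, b.sum_repr, sub_self]

/-- Families which are bases of the steps `D j / K j` of a decreasing flag form together a basis
adapted to the flag. -/
theorem exists_basis_of_flag {V ι : Type*} [AddCommGroup V] [Module k V] [LinearOrder ι]
    [Fintype ι] {a : ι → ℕ} {D K : ι → Submodule k V}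
    {v : ∀ j, Fin (a j) → V} (hv : ∀ j, IsRelBasis (D j) (K j) (v j))
    (hKD : ∀ j, K j ≤ D j) (hDK : ∀ l j, l < j → D j ≤ K l)
    (hK : ∀ j, K j = ⊥ ∨ ∃ l, j < l ∧ K j = D l) (hD : ∀ x, ∃ j, x ∈ D j) :
    ∃ B : Module.Basis (Σ j, Fin (a j)) k V, (∀ j t, B ⟨j, t⟩ = v j t) ∧
      (∀ j x, x ∈ D j ↔ ∀ l, l < j → ∀ t, B.repr x ⟨l, t⟩ = 0) ∧
      (∀ j x, x ∈ K j ↔ ∀ l, l ≤ j → ∀ t, B.repr x ⟨l, t⟩ = 0) := by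
  let f : (Σ j, Fin (a j)) → V := fun s => v s.1 s.2
  have hsum : ∀ c : (Σ j, Fin (a j)) → k, ∑ s, c s • f s = ∑ j, ∑ t, c ⟨j, t⟩ • v j t :=
    fun c => Fintype.sum_sigma _
  have hvan : ∀ (c : (Σ j, Fin (a j)) → k) (j : ι), (∀ l, l < j → ∀ t, c ⟨l, t⟩ = 0) →
      ∑ s, c s • f s - ∑ t, c ⟨j, t⟩ • v j t ∈ K j := by
    intro c j hc
    rw [hsum, ← Finset.add_sum_erase _ _ (Finset.mem_univ j), add_sub_cancel_left]
    refine Submodule.sum_mem _ fun l hl => ?_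
    rcases lt_or_gt_of_ne (Finset.ne_of_mem_erase hl) with h | h
    · simp [hc l h]
    · exact Submodule.sum_mem _ fun t _ => Submodule.smul_mem _ _ (hDK _ _ h ((hv l).mem t))
  have hvanish : ∀ (c : (Σ j, Fin (a j)) → k) (j : ι), ∑ s, c s • f s ∈ K j →
      ∀ l, l ≤ j → ∀ t, c ⟨l, t⟩ = 0 := by
    intro c j hc l
    induction l using WellFoundedLT.induction with
    | ind l ih =>
      intro hlj t
      have h1 := hvan c l fun m hm => ih m hm (hm.le.trans hlj)
      have hKK : K j ≤ K l := by
        rcases hlj.eq_or_lt with rfl | h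
        · exact le_rfl
        · exact (hKD j).trans (hDK _ _ h)
      have h2 := (Submodule.sub_mem_iff_right _ (hKK hc)).mp h1
      exact congrFun ((hv l).indep _ h2) t
  have hli : LinearIndependent k f := by
    rw [Fintype.linearIndependent_iff]
    rintro c hc ⟨j, t⟩
    exact hvanish c j (hc ▸ Submodule.zero_mem _) j le_rfl t
  have hspan : ∀ j x, x ∈ D j → x ∈ Submodule.span k (f '' {s | j ≤ s.1}) := by
    intro j
    induction j using WellFoundedGT.induction with
    | ind j ih =>
      intro x hx
      obtain ⟨c, hc⟩ := (hv j).span x hx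
      have h1 : ∑ t, c t • v j t ∈ Submodule.span k (f '' {s | j ≤ s.1}) :=
        Submodule.sum_mem _ fun t _ => Submodule.smul_mem _ _
          (Submodule.subset_span ⟨⟨j, t⟩, le_rfl, rfl⟩)
      refine (Submodule.sub_mem_iff_left _ h1).mp ?_
      rcases hK j with h | ⟨l, hjl, h⟩
      · rw [h, Submodule.mem_bot] at hc
        rw [hc]
        exact Submodule.zero_mem _
      · rw [h] at hc
        exact Submodule.span_mono (Set.image_mono fun s hs => hjl.le.trans hs) (ih l hjl _ hc)
  let B := Module.Basis.mk hli fun x _ => by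
    obtain ⟨j, hj⟩ := hD x
    exact Submodule.span_mono (Set.image_subset_range _ _) (hspan j x hj)
  have hBf : ∀ s, B s = f s := fun s => Module.Basis.mk_apply hli _ s
  have hBx : ∀ x, ∑ s, B.repr x s • f s = x := fun x => by
    simp_rw [← hBf]
    exact B.sum_repr x
  have hDmem : ∀ j x, x ∈ D j ↔ ∀ l, l < j → ∀ t, B.repr x ⟨l, t⟩ = 0 := by
    intro j x
    constructor
    · intro hx l hl t
      refine hvanish (B.repr x) l ?_ l le_rfl t
      rw [hBx]
      exact hDK l j hl hx
    · intro h
      have h1 := hKD j (hvan (B.repr x) j h)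
      rw [hBx] at h1
      exact (Submodule.sub_mem_iff_left _ (Submodule.sum_mem _ fun t _ =>
        Submodule.smul_mem _ _ ((hv j).mem t))).mp h1
  refine ⟨B, fun j t => hBf ⟨j, t⟩, hDmem, fun j x => ⟨fun hx => ?_, fun h => ?_⟩⟩
  · refine hvanish (B.repr x) j ?_
    rwa [hBx]
  · have h1 := hvan (B.repr x) j fun l hl => h l hl.le
    rw [hBx] at h1
    simpa [h j le_rfl] using h1

theorem repr_sub_sum_smul {V ι : Type*} [AddCommGroup V] [Module k V] {τ : ι → Type*} {j : ι}
    [Fintype (τ j)] (B : Module.Basis (Σ j, τ j) k V) (x : V) (c : τ j → k) (t : τ j) :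
    B.repr (x - ∑ s, c s • B ⟨j, s⟩) ⟨j, t⟩ = B.repr x ⟨j, t⟩ - c t := by
  classical
  simp [Finsupp.single_apply]

section Rel

variable {X Y : Type*} [AddCommGroup X] [Module k X] [AddCommGroup Y] [Module k Y]

theorem mem_rker {L : Submodule k (X × Y)} {x : X} : x ∈ rker L ↔ (x, 0) ∈ L := Iff.rfl

theorem mem_rindef {L : Submodule k (X × Y)} {y : Y} : y ∈ rindef L ↔ (0, y) ∈ L := Iff.rfl

theorem mem_rdom {L : Submodule k (X × Y)} {x : X} : x ∈ rdom L ↔ ∃ y, (x, y) ∈ L := by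
  simp [rdom]

theorem mem_rim {L : Submodule k (X × Y)} {y : Y} : y ∈ rim L ↔ ∃ x, (x, y) ∈ L := by
  simp [rim]

theorem rker_le_rdom (L : Submodule k (X × Y)) : rker L ≤ rdom L :=
  fun _ hx => mem_rdom.mpr ⟨0, hx⟩

theorem rindef_le_rim (L : Submodule k (X × Y)) : rindef L ≤ rim L :=
  fun _ hy => mem_rim.mpr ⟨0, hy⟩

theorem mem_iff_sub_mem_rindef {L : Submodule k (X × Y)} {x : X} {y y' : Y} (h : (x, y') ∈ L) :
    (x, y) ∈ L ↔ y - y' ∈ rindef L := by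
  rw [mem_rindef, ← Submodule.sub_mem_iff_left L h]
  simp

theorem mem_iff_sub_mem_rker {L : Submodule k (X × Y)} {x x' : X} {y : Y} (h : (x', y) ∈ L) :
    (x, y) ∈ L ↔ x - x' ∈ rker L := by
  rw [mem_rker, ← Submodule.sub_mem_iff_left L h]
  simp

theorem sum_smul_mem {τ : Type*} [Fintype τ] {L : Submodule k (X × Y)} {v : τ → X} {w : τ → Y}
    (hvw : ∀ t, (v t, w t) ∈ L) (c : τ → k) : (∑ t, c t • v t, ∑ t, c t • w t) ∈ L := by
  have h := Submodule.sum_mem L fun t (_ : t ∈ Finset.univ) => L.smul_mem (c t) (hvw t)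
  convert h using 1
  ext <;> simp [Prod.fst_sum, Prod.snd_sum]

/-- A relation carries a basis of its domain modulo its kernel to a basis of its image modulo
its indefiniteness. -/
theorem IsRelBasis.of_rel {τ : Type*} [Fintype τ] {L : Submodule k (X × Y)} {v : τ → X}
    {w : τ → Y} (hvw : ∀ t, (v t, w t) ∈ L) (hv : IsRelBasis (rdom L) (rker L) v) :
    IsRelBasis (rim L) (rindef L) w where
  mem t := mem_rim.mpr ⟨_, hvw t⟩
  indep c hc := by
    refine hv.indep c ?_
    exact (mem_iff_sub_mem_rindef (sum_smul_mem hvw c) (y := 0)).mpr (by simpa using hc)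
  span y hy := by
    obtain ⟨x, hx⟩ := mem_rim.mp hy
    obtain ⟨c, hc⟩ := hv.span x (mem_rdom.mpr ⟨y, hx⟩)
    refine ⟨c, (mem_iff_sub_mem_rindef (sum_smul_mem hvw c)).mp
      ((mem_iff_sub_mem_rker hx).mpr ?_)⟩
    simpa using (rker L).neg_mem hc

end Rel

theorem off_add_le {p : ℕ} (α : Fin p → ℕ) {l j : Fin p} (h : l < j) :
    off α l + α l ≤ off α j := by
  unfold off
  rw [add_comm, ← Finset.sum_insert (by simp), Finset.Iio_insert]
  exact Finset.sum_le_sum_of_subset fun m hm =>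
    Finset.mem_Iio.mpr ((Finset.mem_Iic.mp hm).trans_lt h)

theorem coord_lt_off_iff {p n : ℕ} {α : Fin p → ℕ} (hα : ∑ i, α i = n) (l j : Fin p)
    (t : Fin (α l)) : (coord hα l t : ℕ) < off α j ↔ l < j := by
  have ht := t.isLt
  constructor
  · intro h
    by_contra! hjl
    rcases hjl.eq_or_lt with rfl | hlt
    · simp [coord] at h
    · have := off_add_le α hlt
      simp only [coord] at h
      omega
  · intro h
    have := off_add_le α h
    simp only [coord]
    omega

theorem off_add_le_coord_iff {p n : ℕ} {α : Fin p → ℕ} (hα : ∑ i, α i = n) (l j : Fin p)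
    (t : Fin (α l)) : off α j + α j ≤ (coord hα l t : ℕ) ↔ j < l := by
  have ht := t.isLt
  constructor
  · intro h
    by_contra! hjl
    rcases hjl.eq_or_lt with rfl | hlt
    · simp only [coord] at h
      omega
    · have := off_add_le α hlt
      simp only [coord] at h
      omega
  · intro h
    have := off_add_le α h
    simp only [coord]
    omega

theorem coord_bijective {p n : ℕ} {α : Fin p → ℕ} (hα : ∑ i, α i = n) :
    Function.Bijective fun s : Σ i, Fin (α i) => coord hα s.1 s.2 := by
  rw [Fintype.bijective_iff_injective_and_card]
  refine ⟨?_, by simp [hα]⟩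
  rintro ⟨l, t⟩ ⟨j, u⟩ h
  have h' := congrArg Fin.val h
  have hlj : l = j := by
    refine le_antisymm (not_lt.mp fun hlt => ?_) (not_lt.mp fun hlt => ?_)
    · have := (off_add_le_coord_iff hα l j t).mpr hlt
      have := u.isLt
      simp only [coord] at *
      omega
    · have := (off_add_le_coord_iff hα j l u).mpr hlt
      have := t.isLt
      simp only [coord] at *
      omega
  subst hlj
  simp only [coord] at h'
  simp [Fin.ext_iff]
  omega

/-- A basis of `k^n` split into blocks of sizes `a` is carried to the standard one by some element
of `GL(n, k)`. -/
theorem exists_GL_of_basis {q n : ℕ} {a : Fin q → ℕ}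
    (B : Module.Basis (Σ j, Fin (a j)) k (Fin n → k)) (ha : ∑ j, a j = n) :
    ∃ g : GL (Fin n) k, ∀ x l t, Matrix.mulVecLin g.val x (coord ha l t) = B.repr x ⟨l, t⟩ := by
  let e := (B.reindex (Equiv.ofBijective _ (coord_bijective ha))).equivFun
  refine ⟨Matrix.GeneralLinearGroup.toLin.symm
    (LinearMap.GeneralLinearGroup.ofLinearEquiv e), fun x l t => ?_⟩
  have h1 : Matrix.mulVecLin (Matrix.GeneralLinearGroup.toLin.symm
      (LinearMap.GeneralLinearGroup.ofLinearEquiv e)).val = e.toLinearMap :=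
    Matrix.toLin'_toMatrix' e.toLinearMap
  rw [h1]
  have h2 : (Equiv.ofBijective _ (coord_bijective ha)).symm (coord ha l t) = ⟨l, t⟩ :=
    (Equiv.symm_apply_eq _).mpr rfl
  rw [LinearEquiv.coe_coe, Module.Basis.equivFun_apply, Module.Basis.repr_reindex_apply, h2]

theorem sum_eq_of_basis {q n : ℕ} {a : Fin q → ℕ}
    (B : Module.Basis (Σ j, Fin (a j)) k (Fin n → k)) : ∑ j, a j = n := by
  have h := Module.finrank_eq_card_basis B
  simpa using h.symm

/-- Membership in a standard bi-hinge in terms of block coordinates. -/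
theorem mem_stdHinge_iff {p q : ℕ} {α : Fin p → ℕ} {β : Fin q → ℕ} {a : Fin p → Fin q → ℕ}
    (hA : ∀ i, ∑ j, a i j = α i) (hB : ∀ j, ∑ i, a i j = β j) (i : Fin p) (j : Fin q)
    (z : (Fin (α i) → k) × (Fin (β j) → k)) :
    z ∈ stdHinge α β a i j ↔
      (∀ l, l < j → ∀ t, z.1 (coord (hA i) l t) = 0) ∧
      (∀ l, i < l → ∀ t, z.2 (coord (hB j) l t) = 0) ∧
      ∀ t, z.1 (coord (hA i) j t) = z.2 (coord (hB j) i t) := by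
  refine and_congr ⟨fun h l hl t => ?_, fun h u hu => ?_⟩
    (and_congr ⟨fun h l hl t => ?_, fun h u hu => ?_⟩
      ⟨fun h t => ?_, fun h u v t ht hu hv => ?_⟩)
  · exact h _ ((coord_lt_off_iff (hA i) l j t).mpr hl)
  · obtain ⟨⟨l, t⟩, rfl⟩ := (coord_bijective (hA i)).surjective u
    exact h l ((coord_lt_off_iff (hA i) l j t).mp hu) t
  · exact h _ ((off_add_le_coord_iff (hB j) l i t).mpr hl)
  · obtain ⟨⟨l, t⟩, rfl⟩ := (coord_bijective (hB j)).surjective u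
    exact h l ((off_add_le_coord_iff (hB j) l i t).mp hu) t
  · exact h _ _ t t.isLt rfl rfl
  · convert h ⟨t, ht⟩ using 2
    · exact Fin.ext hu
    · exact Fin.ext hv

theorem antitone_fin_of_succ_le {q : ℕ} {P : Type*} [Preorder P] {D : Fin q → P}
    (h : ∀ j j' : Fin q, (j' : ℕ) = (j : ℕ) + 1 → D j' ≤ D j) : Antitone D := by
  intro l j hlj
  obtain ⟨j, hj⟩ := j
  induction j with
  | zero =>
    obtain rfl : l = ⟨0, hj⟩ := Fin.ext (Nat.le_zero.mp hlj)
    exact le_rfl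
  | succ m ih =>
    rcases hlj.eq_or_lt with rfl | hlt
    · exact le_rfl
    · exact (h ⟨m, by omega⟩ ⟨m + 1, hj⟩ rfl).trans
        (ih (by omega) (Nat.lt_succ_iff.mp hlt))

/-- The domains and kernels in a row of a bi-hinge form a decreasing flag. -/
theorem exists_basis_row {q : ℕ} {V : Type*} [AddCommGroup V] [Module k V]
    (hq : 0 < q) {a : Fin q → ℕ} {D K : Fin q → Submodule k V} {v : ∀ j, Fin (a j) → V}
    (hv : ∀ j, IsRelBasis (D j) (K j) (v j)) (hKD : ∀ j, K j ≤ D j)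
    (hsucc : ∀ j j' : Fin q, (j' : ℕ) = (j : ℕ) + 1 → K j = D j')
    (hbot : ∀ j : Fin q, (j : ℕ) + 1 = q → K j = ⊥)
    (htop : ∀ j : Fin q, (j : ℕ) = 0 → D j = ⊤) :
    ∃ B : Module.Basis (Σ j, Fin (a j)) k V, (∀ j t, B ⟨j, t⟩ = v j t) ∧
      (∀ j x, x ∈ D j ↔ ∀ l, l < j → ∀ t, B.repr x ⟨l, t⟩ = 0) ∧
      (∀ j x, x ∈ K j ↔ ∀ l, l ≤ j → ∀ t, B.repr x ⟨l, t⟩ = 0) := by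
  have hanti : Antitone D := antitone_fin_of_succ_le fun j j' h => hsucc j j' h ▸ hKD j
  refine exists_basis_of_flag hv hKD (fun l j hlj => ?_) (fun j => ?_)
    fun x => ⟨⟨0, hq⟩, htop ⟨0, hq⟩ rfl ▸ Submodule.mem_top⟩
  · have hlt : (l : ℕ) + 1 < q := lt_of_le_of_lt (Nat.succ_le_of_lt hlj) j.isLt
    rw [hsucc l ⟨l + 1, hlt⟩ rfl]
    exact hanti (Nat.succ_le_of_lt hlj)
  · by_cases hj : (j : ℕ) + 1 = q
    · exact Or.inl (hbot j hj)
    · exact Or.inr ⟨⟨j + 1, by omega⟩, Nat.lt_succ_self _, hsucc _ _ rfl⟩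

/-- The images and indefinitenesses in a column of a bi-hinge form an increasing flag. -/
theorem exists_basis_column {p : ℕ} {V : Type*} [AddCommGroup V] [Module k V]
    (hp : 0 < p) {a : Fin p → ℕ} {D K : Fin p → Submodule k V} {v : ∀ j, Fin (a j) → V}
    (hv : ∀ i, IsRelBasis (D i) (K i) (v i)) (hKD : ∀ i, K i ≤ D i)
    (hsucc : ∀ i i' : Fin p, (i' : ℕ) = (i : ℕ) + 1 → D i = K i')
    (hbot : ∀ i : Fin p, (i : ℕ) = 0 → K i = ⊥)
    (htop : ∀ i : Fin p, (i : ℕ) + 1 = p → D i = ⊤) :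
    ∃ B : Module.Basis (Σ i, Fin (a i)) k V, (∀ i t, B ⟨i, t⟩ = v i t) ∧
      (∀ i x, x ∈ D i ↔ ∀ l, i < l → ∀ t, B.repr x ⟨l, t⟩ = 0) ∧
      (∀ i x, x ∈ K i ↔ ∀ l, i ≤ l → ∀ t, B.repr x ⟨l, t⟩ = 0) := by
  have hmono : Monotone K := fun i i' hii' => antitone_fin_of_succ_le (P := (Submodule k V)ᵒᵈ)
    (D := K) (fun i i' h => show K i ≤ K i' from hsucc i i' h ▸ hKD i) hii'
  refine exists_basis_of_flag (ι := (Fin p)ᵒᵈ) (a := a) hv hKD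
    (fun (l j : Fin p) (hlj : j < l) => ?_) (fun j : Fin p => ?_)
    fun x => ⟨(⟨p - 1, by omega⟩ : Fin p), ?_⟩
  · have hlt : (j : ℕ) + 1 < p := lt_of_le_of_lt (Nat.succ_le_of_lt hlj) l.isLt
    rw [hsucc j ⟨j + 1, hlt⟩ rfl]
    exact hmono (Nat.succ_le_of_lt hlj)
  · by_cases hj : (j : ℕ) = 0
    · exact Or.inl (hbot j hj)
    · refine Or.inr ⟨(⟨j - 1, by omega⟩ : Fin p), ?_, (hsucc _ _ ?_).symm⟩
      · show (j : ℕ) - 1 < j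
        omega
      · show (j : ℕ) = j - 1 + 1
        omega
  · rw [htop ⟨p - 1, by omega⟩ (Nat.sub_add_cancel hp)]
    exact Submodule.mem_top

theorem statement12 (p q n : ℕ) (hp : 0 < p) (hq : 0 < q)
    (α : Fin p → ℕ) (β : Fin q → ℕ)
    (hαpos : ∀ i, 0 < α i) (hβpos : ∀ j, 0 < β j)
    (hα : ∑ i, α i = n) (hβ : ∑ j, β j = n)
    (ξ : (i : Fin p) → (j : Fin q) → Submodule k ((Fin (α i) → k) × (Fin (β j) → k)))
    (hξ : IsBiHinge α β ξ) :
    ∃ (g : ∀ i, GL (Fin (α i)) k) (h : ∀ j, GL (Fin (β j)) k) (a : Fin p → Fin q → ℕ),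
      (∀ i, ∑ j, a i j = α i) ∧ (∀ j, ∑ i, a i j = β j) ∧
      ∀ (i : Fin p) (j : Fin q),
        Submodule.map
          (LinearMap.prodMap (Matrix.mulVecLin (g i).val) (Matrix.mulVecLin (h j).val))
          (ξ i j) = stdHinge α β a i j := by
  obtain ⟨hker, him, hindef, himtop, hkerbot, hdomtop⟩ := hξ
  choose a v hv using fun i j => exists_isRelBasis (rdom (ξ i j)) (rker (ξ i j))
  choose w hvw using fun i j t => mem_rdom.mp ((hv i j).mem t)
  have hw : ∀ i j, IsRelBasis (rim (ξ i j)) (rindef (ξ i j)) (w i j) :=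
    fun i j => (hv i j).of_rel (hvw i j)
  choose B hBv hBdom hBker using fun i => exists_basis_row hq (hv i)
    (fun j => rker_le_rdom (ξ i j)) (hker i) (hkerbot i) (hdomtop i)
  choose C hCw hCim hCindef using fun j => exists_basis_column hp (fun i => hw i j)
    (fun i => rindef_le_rim (ξ i j)) (fun i i' => him i i' j) (fun i => hindef i j)
    (fun i => himtop i j)
  have hA : ∀ i, ∑ j, a i j = α i := fun i => sum_eq_of_basis (B i)
  have hA' : ∀ j, ∑ i, a i j = β j := fun j => sum_eq_of_basis (C j)
  choose g hg using fun i => exists_GL_of_basis (B i) (hA i)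
  choose h hh using fun j => exists_GL_of_basis (C j) (hA' j)
  refine ⟨g, h, a, hA, hA', fun i j => ?_⟩
  have hmem : ∀ x y, (x, y) ∈ ξ i j ↔ ((g i).val.mulVecLin x, (h j).val.mulVecLin y) ∈
      stdHinge α β a i j := by
    intro x y
    rw [mem_stdHinge_iff hA hA']
    simp only [hg, hh, ← hBdom, ← hCim]
    have hxyL : ∀ hx : x ∈ rdom (ξ i j), ∀ hy : y ∈ rim (ξ i j), (x, y) ∈ ξ i j ↔
        ∀ t, (B i).repr x ⟨j, t⟩ = (C j).repr y ⟨i, t⟩ := by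
      intro hx hy
      obtain ⟨c, hc⟩ := (hv i j).span x hx
      obtain ⟨d, hd⟩ := (hw i j).span y hy
      have hx' : (x, ∑ t, c t • w i j t) ∈ ξ i j :=
        (mem_iff_sub_mem_rker (sum_smul_mem (hvw i j) c)).mpr hc
      have hBc : ∀ t, (B i).repr x ⟨j, t⟩ = c t := fun t => by
        have h1 := (hBker i j _).mp hc j le_rfl t
        simpa only [← hBv, repr_sub_sum_smul, sub_eq_zero] using h1
      have hC : ∀ e : Fin (a i j) → k, y - ∑ t, e t • w i j t ∈ rindef (ξ i j) →
          ∀ t, (C j).repr y ⟨i, t⟩ = e t := fun e he t => by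
        have h1 := (hCindef j i _).mp he i le_rfl t
        simpa only [← hCw, repr_sub_sum_smul, sub_eq_zero] using h1
      rw [mem_iff_sub_mem_rindef hx']
      refine ⟨fun h1 t => (hBc t).trans (hC c h1 t).symm, fun h1 => ?_⟩
      obtain rfl : c = d := funext fun t => (hBc t).symm.trans ((h1 t).trans (hC d hd t))
      exact hd
    constructor
    · intro hxy
      have hx : x ∈ rdom (ξ i j) := mem_rdom.mpr ⟨y, hxy⟩
      have hy : y ∈ rim (ξ i j) := mem_rim.mpr ⟨x, hxy⟩
      exact ⟨hx, hy, (hxyL hx hy).mp hxy⟩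
    · rintro ⟨hx, hy, hxy⟩
      exact (hxyL hx hy).mpr hxy
  refine le_antisymm ?_ fun z hz => ?_
  · rintro _ ⟨⟨x, y⟩, hxy, rfl⟩
    exact (hmem x y).mp hxy
  · obtain ⟨x, hx⟩ := (Matrix.mulVec_surjective_iff_isUnit.mpr (g i).isUnit) z.1
    obtain ⟨y, hy⟩ := (Matrix.mulVec_surjective_iff_isUnit.mpr (h j).isUnit) z.2
    have hz' : ((g i).val.mulVecLin x, (h j).val.mulVecLin y) = z := Prod.ext hx hy
    exact ⟨(x, y), (hmem x y).mpr (hz' ▸ hz), hz'⟩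

end Neretin
end

section
/- An orbit of ∏_{i=1}^p GL(α_i,k) × ∏_{j=1}^q GL(β_j,k) on the set of bi-hinges contains at most one standard bi-hinge: if the standard bi-hinges determined by dimension data (α_i^j) and (α'_i^j) lie in the same orbit, then α_i^j = α'_i^j for all i, j, and hence the two standard bi-hinges coincide. (Uniqueness part of Lemma 2.3(a).) -/
namespace Neretin

open scoped BigOperators

variable {k : Type*} [Field k]

theorem finrank_vanishOn_lt (m d : ℕ) :
    Module.finrank k (vanishOn (k := k) fun u : Fin m => (u : ℕ) < d) = m - d := by
  classical
  have e : vanishOn (k := k) (fun u : Fin m => (u : ℕ) < d) ≃ₗ[k]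
      ({u : Fin m | d ≤ (u : ℕ)} → k) :=
    LinearMap.iInfKerProjEquiv k (fun _ : Fin m => k)
      (Set.disjoint_left.mpr fun u (hu : d ≤ (u : ℕ)) (hu' : (u : ℕ) < d) => by omega)
      (fun u _ => le_or_gt d (u : ℕ))
  rw [e.finrank_eq, Module.finrank_fintype_fun_eq_card, Fintype.card_subtype]
  have hlt : (Finset.univ.filter fun u : Fin m => (u : ℕ) < d).card = min m d := by
    simp [Fin.card_filter_val_lt]
  have hsum := Finset.card_filter_add_card_filter_not
    (s := (Finset.univ : Finset (Fin m))) (fun u => (u : ℕ) < d)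
  simp only [not_lt, Finset.card_univ, Fintype.card_fin] at hsum
  simp only [Set.mem_ofPred_eq]
  omega

theorem sum_Iio_add_le {m : ℕ} (f : Fin m → ℕ) (i : Fin m) :
    ∑ i' ∈ Finset.Iio i, f i' + f i ≤ ∑ i', f i' := by
  rw [add_comm, ← Finset.sum_insert (by simp)]
  exact Finset.sum_le_sum_of_subset (Finset.subset_univ _)

section Rel

variable {X Y X' Y' : Type*} [AddCommGroup X] [Module k X] [AddCommGroup Y] [Module k Y]
  [AddCommGroup X'] [Module k X'] [AddCommGroup Y'] [Module k Y']

theorem rdom_map_prodMap (g : X →ₗ[k] X') (h : Y →ₗ[k] Y') (L : Submodule k (X × Y)) :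
    rdom (L.map (g.prodMap h)) = (rdom L).map g := by
  unfold rdom
  rw [← Submodule.map_comp, ← Submodule.map_comp]
  rfl

theorem rker_map_prodMap (g : X →ₗ[k] X') {h : Y →ₗ[k] Y'} (hh : Function.Injective h)
    (L : Submodule k (X × Y)) :
    rker (L.map (g.prodMap h)) = (rker L).map g := by
  ext x
  constructor
  · rintro ⟨⟨y, z⟩, hL, hyz⟩
    obtain ⟨hy, hz⟩ := Prod.ext_iff.mp hyz
    obtain rfl : z = 0 := hh (hz.trans (map_zero h).symm)
    exact ⟨y, hL, hy⟩
  · rintro ⟨y, hL, rfl⟩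
    exact ⟨(y, 0), hL, by simp⟩

end Rel

section StdHinge

variable {p q : ℕ} {α : Fin p → ℕ} {β : Fin q → ℕ} {a : Fin p → Fin q → ℕ}

theorem rdom_stdHinge (hrow : ∀ i, ∑ j, a i j = α i) (i : Fin p) (j : Fin q) :
    rdom (stdHinge (k := k) α β a i j) = vanishOn fun u : Fin (α i) => (u : ℕ) < offA a i j := by
  have hA : offA a i j + a i j ≤ α i := hrow i ▸ sum_Iio_add_le (a i) j
  ext x
  rw [mem_vanishOn]
  constructor
  · rintro ⟨z, hz, rfl⟩
    exact hz.1
  · intro hx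
    refine ⟨(x, fun v => if hv : offB a i j ≤ (v : ℕ) ∧ (v : ℕ) < offB a i j + a i j then
      x ⟨offA a i j + ((v : ℕ) - offB a i j), by omega⟩ else 0), ⟨hx, ?_, ?_⟩, rfl⟩
    · intro v hv
      exact dif_neg (by omega)
    · intro u v t ht hu hv
      change x u = dite _ _ _
      rw [dif_pos (by omega)]
      congr 1
      ext
      change (u : ℕ) = offA a i j + ((v : ℕ) - offB a i j)
      omega

theorem rker_stdHinge (hcol : ∀ j, ∑ i, a i j = β j) (i : Fin p) (j : Fin q) :
    rker (stdHinge (k := k) α β a i j) =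
      vanishOn fun u : Fin (α i) => (u : ℕ) < offA a i j + a i j := by
  have hB : offB a i j + a i j ≤ β j := hcol j ▸ sum_Iio_add_le (fun i' => a i' j) i
  ext x
  rw [mem_vanishOn]
  constructor
  · rintro ⟨h1, -, h3⟩ u hu
    rcases lt_or_ge (u : ℕ) (offA a i j) with h | h
    · exact h1 u h
    · exact h3 u ⟨offB a i j + ((u : ℕ) - offA a i j), by omega⟩ ((u : ℕ) - offA a i j)
        (by omega) (by omega) rfl
  · intro hx
    exact ⟨fun u hu => hx u (by omega), fun _ _ => rfl,
      fun u v t ht hu hv => hx u (by omega)⟩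

theorem finrank_rdom_stdHinge (hrow : ∀ i, ∑ j, a i j = α i)
    (hcol : ∀ j, ∑ i, a i j = β j) (i : Fin p) (j : Fin q) :
    Module.finrank k (rdom (stdHinge (k := k) α β a i j)) =
      a i j + Module.finrank k (rker (stdHinge (k := k) α β a i j)) := by
  have hA : offA a i j + a i j ≤ α i := hrow i ▸ sum_Iio_add_le (a i) j
  rw [rdom_stdHinge hrow, rker_stdHinge hcol, finrank_vanishOn_lt, finrank_vanishOn_lt]
  omega

end StdHinge

theorem statement13 (p q n : ℕ) (hp : 0 < p) (hq : 0 < q)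
    (α : Fin p → ℕ) (β : Fin q → ℕ)
    (hαpos : ∀ i, 0 < α i) (hβpos : ∀ j, 0 < β j)
    (hα : ∑ i, α i = n) (hβ : ∑ j, β j = n)
    (a a' : Fin p → Fin q → ℕ)
    (hrow : ∀ i, ∑ j, a i j = α i) (hcol : ∀ j, ∑ i, a i j = β j)
    (hrow' : ∀ i, ∑ j, a' i j = α i) (hcol' : ∀ j, ∑ i, a' i j = β j)
    (horb : ∃ (g : ∀ i, GL (Fin (α i)) k) (h : ∀ j, GL (Fin (β j)) k),
      ∀ (i : Fin p) (j : Fin q),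
        Submodule.map
          (LinearMap.prodMap (Matrix.mulVecLin (g i).val) (Matrix.mulVecLin (h j).val))
          (stdHinge α β a i j) = stdHinge (k := k) α β a' i j) :
    a = a' := by
  obtain ⟨g, h, hgh⟩ := horb
  funext i j
  have hg : Function.Injective (Matrix.mulVecLin (g i).val) :=
    Matrix.mulVec_injective_of_isUnit (g i).isUnit
  have hh : Function.Injective (Matrix.mulVecLin (h j).val) :=
    Matrix.mulVec_injective_of_isUnit (h j).isUnit
  have hd := finrank_rdom_stdHinge (k := k) hrow hcol i j
  have hd' := finrank_rdom_stdHinge (k := k) hrow' hcol' i j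
  rw [← hgh, rdom_map_prodMap, rker_map_prodMap _ hh,
    ← (Submodule.equivMapOfInjective _ hg _).finrank_eq,
    ← (Submodule.equivMapOfInjective _ hg _).finrank_eq] at hd'
  omega

end Neretin
end

section
/- The normalizer of T_+(α_1,...,α_p) in GL(n,k) equals P_+(α_1,...,α_p): a matrix g ∈ GL(n,k) satisfies g·T_+(α_1,...,α_p)·g^{−1} = T_+(α_1,...,α_p) if and only if g is block upper triangular with respect to the partition (α_1,...,α_p). -/
namespace Neretin

open scoped BigOperators

variable {k : Type*} [Field k]

/-- The number of blocks starting at or before the coordinate `a`. -/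
def blockLevel {p : ℕ} (α : Fin p → ℕ) (a : ℕ) : ℕ :=
  (Finset.univ.filter fun i : Fin p => off α i ≤ a).card

theorem blockLT_iff {p : ℕ} (α : Fin p → ℕ) (a b : ℕ) :
    blockLT α a b ↔ blockLevel α a < blockLevel α b := by
  constructor
  · rintro ⟨i, hib, hai⟩
    refine Finset.card_lt_card (Finset.ssubset_iff_of_subset ?_ |>.2 ⟨i, ?_, ?_⟩)
    · intro j hj
      simp only [Finset.mem_filter, Finset.mem_univ, true_and] at hj ⊢
      omega
    · simpa using hib
    · simpa using hai
  · intro h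
    obtain ⟨i, hib, hia⟩ := Finset.exists_mem_notMem_of_card_lt_card h
    exact ⟨i, by simpa using hib, by simpa using hia⟩

theorem sameBlock_iff {p : ℕ} (α : Fin p → ℕ) (a b : ℕ) :
    sameBlock α a b ↔ blockLevel α a = blockLevel α b := by
  constructor
  · intro h
    unfold blockLevel
    simp only [h _]
  · intro h i
    constructor
    · intro hi
      by_contra hb
      exact ((blockLT_iff α b a).1 ⟨i, hi, not_le.1 hb⟩).ne' h
    · intro hi
      by_contra ha
      exact ((blockLT_iff α a b).1 ⟨i, hi, not_le.1 ha⟩).ne h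

theorem isPPlus_iff_blockTriangular {n p : ℕ} (α : Fin p → ℕ) (g : Matrix (Fin n) (Fin n) k) :
    IsPPlus α g ↔ g.BlockTriangular fun r => blockLevel α r := by
  simp only [IsPPlus, blockLT_iff, Matrix.BlockTriangular]

theorem isTPlus_iff {n p : ℕ} (α : Fin p → ℕ) (g : Matrix (Fin n) (Fin n) k) :
    IsTPlus α g ↔ ∀ r s : Fin n, blockLevel α s ≤ blockLevel α r → (g - 1) r s = 0 := by
  simp only [IsTPlus, IsPPlus, blockLT_iff, sameBlock_iff, Matrix.sub_apply, Matrix.one_apply,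
    sub_eq_zero]
  constructor
  · rintro ⟨hlt, heq⟩ r s hsr
    rcases hsr.lt_or_eq with h | h
    · rw [hlt r s h, if_neg]
      rintro rfl
      exact h.false
    · exact heq r s h.symm
  · refine fun h => ⟨fun r s hsr => ?_, fun r s hrs => h r s hrs.ge⟩
    rw [h r s hsr.le, if_neg]
    rintro rfl
    exact hsr.false

section BlockLevels

variable {ι : Type*} [Fintype ι] {l : ι → ℕ}

/-- Multiplying a strictly block triangular matrix by block triangular ones on both sides gives a
strictly block triangular matrix. -/
theorem strict_mul_mul {g N h : Matrix ι ι k} (hg : g.BlockTriangular l)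
    (hN : ∀ r s, l s ≤ l r → N r s = 0) (hh : h.BlockTriangular l) :
    ∀ r s, l s ≤ l r → (g * N * h) r s = 0 := by
  intro r s hsr
  rw [Matrix.mul_apply]
  refine Finset.sum_eq_zero fun b _ => ?_
  rcases lt_or_ge (l s) (l b) with hb | hb
  · rw [hh hb, mul_zero]
  · rw [Matrix.mul_apply, Finset.sum_eq_zero, zero_mul]
    intro a _
    rcases lt_or_ge (l a) (l r) with ha | ha
    · rw [hg ha, zero_mul]
    · rw [hN a b (by omega), mul_zero]

/-- If `h` has a right inverse and its rows of level above `c` are supported on the columns of level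
above `d`, then there are at least as many such columns as rows. -/
theorem card_le_of_rows_supported [DecidableEq ι] {h g : Matrix ι ι k} (hg : h * g = 1) {c d : ℕ}
    (hs : ∀ b s, c < l b → l s ≤ d → h b s = 0) :
    Fintype.card {b // c < l b} ≤ Fintype.card {s // d < l s} := by
  let A : Matrix {b // c < l b} {s // d < l s} k := h.submatrix Subtype.val Subtype.val
  let B : Matrix {s // d < l s} {b // c < l b} k := g.submatrix Subtype.val Subtype.val
  have hAB : A * B = 1 := by
    ext b b'
    calc (A * B) b b' = ∑ s : {s // d < l s}, h b s * g s b' := rfl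
      _ = ∑ s with d < l s, h b s * g s b' :=
        (Finset.sum_subtype (Finset.univ.filter fun s => d < l s) (by simp)
          fun s => h b s * g s b').symm
      _ = ∑ s, h b s * g s b' := by
        refine Finset.sum_subset (Finset.filter_subset _ _) fun s _ hsd => ?_
        rw [hs b s b.2 (by simpa using hsd), zero_mul]
      _ = (h * g) b b' := (Matrix.mul_apply ..).symm
      _ = (1 : Matrix {b // c < l b} {b // c < l b} k) b b' := by
        simp [hg, Matrix.one_apply, Subtype.ext_iff]
  calc Fintype.card {b // c < l b} = (A * B).rank := by rw [hAB, Matrix.rank_one]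
    _ ≤ A.rank := Matrix.rank_mul_le_left A B
    _ ≤ Fintype.card {s // d < l s} := A.rank_le_card_width

/-- An invertible matrix conjugating all elementary strictly block triangular matrices to strictly
block triangular ones is block triangular. -/
theorem blockTriangular_of_conj_single [DecidableEq ι] {g h : Matrix ι ι k} (hhg : h * g = 1)
    (hconj : ∀ a b, l a < l b → ∀ r s, l s ≤ l r →
      (g * (Matrix.single a b 1 : Matrix ι ι k) * h) r s = 0) :
    g.BlockTriangular l := by
  intro r a har
  by_contra hne
  have hcard := card_le_of_rows_supported (l := l) hhg (c := l a) (d := l r) fun b s hb hs => by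
    have hab := hconj a b hb r s hs
    rw [Matrix.mul_apply, Finset.sum_eq_single b
      (fun j _ hj => by rw [Matrix.mul_single_apply_of_ne _ _ _ _ _ hj, zero_mul]) (by simp),
      Matrix.mul_single_apply_same, mul_one] at hab
    exact (mul_eq_zero.1 hab).resolve_left hne
  rw [Fintype.card_subtype, Fintype.card_subtype] at hcard
  refine hcard.not_gt (Finset.card_lt_card (Finset.ssubset_iff_of_subset ?_ |>.2 ⟨r, ?_, ?_⟩))
  · intro s hs
    simp only [Finset.mem_filter, Finset.mem_univ, true_and] at hs ⊢
    exact har.trans hs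
  · simpa using har
  · simp

end BlockLevels

theorem statement16 (p n : ℕ) (hp : 0 < p)
    (α : Fin p → ℕ) (hαpos : ∀ i, 0 < α i) (hα : ∑ i, α i = n)
    (g : GL (Fin n) k) :
    (∀ t : GL (Fin n) k, IsTPlus α t.val ↔ IsTPlus α ((g * t * g⁻¹).val)) ↔
      IsPPlus α g.val := by
  have hconj (t : Matrix (Fin n) (Fin n) k) :
      g.val * t * (g⁻¹).val - 1 = g.val * (t - 1) * (g⁻¹).val := by
    rw [mul_sub, sub_mul, mul_one, Units.mul_inv]
  simp only [isTPlus_iff, isPPlus_iff_blockTriangular, Units.val_mul, hconj]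
  constructor
  · intro h
    refine blockTriangular_of_conj_single g.inv_mul fun a b hab => ?_
    have hne : a ≠ b := by
      rintro rfl
      exact hab.false
    let t : GL (Fin n) k := Matrix.GeneralLinearGroup.mkOfDetNeZero (Matrix.transvection a b 1)
      (by rw [Matrix.det_transvection_of_ne a b hne]; exact one_ne_zero)
    have ht : t.val - 1 = Matrix.single a b 1 := by
      simp [t, Matrix.GeneralLinearGroup.mkOfDetNeZero, Matrix.transvection]
    have h' := (h t).1
    rw [ht] at h'
    refine h' fun r s hsr => Matrix.single_apply_of_ne _ _ _ _ _ ?_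
    rintro ⟨rfl, rfl⟩
    exact hab.not_ge hsr
  · intro hg t
    have hg' : (g⁻¹).val.BlockTriangular fun r : Fin n => blockLevel α r := by
      have : Invertible g.val := g.invertible
      rw [Matrix.coe_units_inv]
      exact Matrix.blockTriangular_inv_of_blockTriangular hg
    refine ⟨fun ht => strict_mul_mul hg ht hg', fun ht => ?_⟩
    have hback := strict_mul_mul hg' ht hg
    rwa [← mul_assoc, ← mul_assoc, Units.inv_mul, one_mul, mul_assoc, Units.inv_mul,
      mul_one] at hback

end Neretin
end
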